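/- arXiv:2302.02053 — 4 statements merged into one kernel-verified Lean document; each statement's English description precedes it below -/
import Mathlib

section
/- Let k ≥ 1 be an integer and place equally spaced knots s_i = i/k (i = 0,…,k) on [0,1]. Let φ_i denote the order-1 O-spline basis functions, i.e. φ_i(x) = 0 for x ≤ s_{i−1}, φ_i(x) = x − s_{i−1} for s_{i−1} < x ≤ s_i, and φ_i(x) = 1/k for x > s_i. Then for all s, t ∈ [0,1]: 0 ≤ min(s,t) − k·Σ_{i=1}^k φ_i(s)·φ_i(t) ≤ 2/k. In particular, sup_{s,t∈[0,1]} |min(s,t) − k Σ_{i=1}^k φ_i(s)φ_i(t)| ≤ 2/k, where min(s,t) is the covariance function of the standard Wiener process (first-order IWP) and k Σ_i φ_i(s)φ_i(t) is the covariance function of its order-1 O-spline approximation. -/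
open MeasureTheory Finset

/-- The order-`m` O-spline basis function with equally spaced knots `s_i = i/k` on `[0,1]`,
associated to the knot interval `(s_{i-1}, s_i]`. -/
noncomputable def ospline (m k i : ℕ) (x : ℝ) : ℝ :=
  if x ≤ ((i : ℝ) - 1) / k then 0
  else if x ≤ (i : ℝ) / k then (x - ((i : ℝ) - 1) / k) ^ m / (Nat.factorial m)
  else ((x - ((i : ℝ) - 1) / k) ^ m - (x - (i : ℝ) / k) ^ m) / (Nat.factorial m)

lemma ospline_one_eq (k i : ℕ) (x : ℝ) (hk : 1 ≤ k) :
    ospline 1 k (i + 1) x = min x (((i + 1 : ℕ) : ℝ) / k) - min x ((i : ℝ) / k) := by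
  have hk' : (0 : ℝ) < k := by exact_mod_cast hk
  have h1 : (i : ℝ) / k ≤ ((i : ℝ) + 1) / k := by gcongr; linarith
  unfold ospline
  push_cast
  rw [add_sub_cancel_right]
  split_ifs with h h2
  · rw [min_eq_left h, min_eq_left (h.trans h1)]; simp
  · rw [min_eq_left h2, min_eq_right (not_le.1 h).le]; simp
  · rw [min_eq_right (not_le.1 h2).le, min_eq_right (not_le.1 h).le]; simp

lemma ospline_sum_aux (k : ℕ) (hk : 1 ≤ k) (x : ℝ) (h0 : 0 ≤ x) (n : ℕ) :
    ∑ i ∈ Finset.range n, ospline 1 k (i + 1) x = min x ((n : ℝ) / k) := by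
  simp_rw [fun i => ospline_one_eq k i x hk]
  rw [Finset.sum_range_sub (fun i : ℕ => min x ((i : ℝ) / k))]
  simp [h0]

lemma ospline_bounds (k i : ℕ) (x : ℝ) (hk : 1 ≤ k) :
    0 ≤ ospline 1 k (i + 1) x ∧ k * ospline 1 k (i + 1) x ≤ 1 := by
  have hk' : (0 : ℝ) < k := by exact_mod_cast hk
  have h1 : ((i : ℝ) + 1) / k = (i : ℝ) / k + 1 / k := by ring
  have h2 : (0 : ℝ) < 1 / k := by positivity
  have h3 : (k : ℝ) * (1 / k) = 1 := by field_simp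
  rw [ospline_one_eq k i x hk]
  push_cast
  rw [h1]
  have h4 : 0 ≤ min x ((i : ℝ) / k + 1 / k) - min x ((i : ℝ) / k) ∧
      min x ((i : ℝ) / k + 1 / k) - min x ((i : ℝ) / k) ≤ 1 / k := by
    constructor <;> grind
  exact ⟨h4.1, by nlinarith [h4.2]⟩

lemma ospline_mono (k i : ℕ) (x y : ℝ) (hk : 1 ≤ k) (hxy : x ≤ y) :
    ospline 1 k (i + 1) x ≤ ospline 1 k (i + 1) y := by
  have h1 : (i : ℝ) / k ≤ ((i : ℝ) + 1) / k := by gcongr; linarith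
  rw [ospline_one_eq k i x hk, ospline_one_eq k i y hk]
  push_cast
  grind

lemma ospline_err (k : ℕ) (hk : 1 ≤ k) (x : ℝ) (n : ℕ) :
    ∑ i ∈ Finset.range n, ospline 1 k (i + 1) x * (1 - k * ospline 1 k (i + 1) x) ≤
      if (n : ℝ) / k ≤ x then (0 : ℝ) else 1 / (k : ℝ) := by
  have hk' : (0 : ℝ) < k := by exact_mod_cast hk
  have h2 : (0 : ℝ) < 1 / k := by positivity
  have h3 : (k : ℝ) * (1 / k) = 1 := by field_simp
  induction n with
  | zero => simp only [Finset.range_zero, Finset.sum_empty]; split_ifs <;> linarith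
  | succ n ih =>
    rw [Finset.sum_range_succ]
    obtain ⟨b0, b1⟩ := ospline_bounds k n x hk
    have e := ospline_one_eq k n x hk
    have h1 : (((n + 1 : ℕ) : ℝ)) / k = (n : ℝ) / k + 1 / k := by push_cast; ring
    rw [h1] at e ⊢
    set a := ospline 1 k (n + 1) x
    by_cases c1 : (n : ℝ) / k + 1 / k ≤ x
    · rw [if_pos (by linarith)] at ih
      rw [if_pos c1]
      rw [min_eq_right c1, min_eq_right (by linarith)] at e
      have : a = 1 / k := by linarith
      rw [this, h3]; linarith
    · rw [if_neg c1]
      by_cases c2 : (n : ℝ) / k ≤ x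
      · rw [if_pos c2] at ih
        have : a ≤ 1 / k := by rw [le_div_iff₀ hk']; linarith
        have : 0 ≤ a * (k * a) := by positivity
        linarith
      · rw [if_neg c2] at ih
        rw [min_eq_left (by linarith), min_eq_left (by linarith)] at e
        have : a = 0 := by linarith
        rw [this]; linarith

lemma ospline_main (k : ℕ) (hk : 1 ≤ k) (s t : ℝ) (hs : s ∈ Set.Icc (0 : ℝ) 1) (hst : s ≤ t) :
    0 ≤ s - (k : ℝ) * ∑ i ∈ Finset.Icc 1 k, ospline 1 k i s * ospline 1 k i t ∧
      s - (k : ℝ) * ∑ i ∈ Finset.Icc 1 k, ospline 1 k i s * ospline 1 k i t ≤ 2 / k := by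
  have hk' : (0 : ℝ) < k := by exact_mod_cast hk
  have h2 : (0 : ℝ) < 1 / k := by positivity
  have hsum := ospline_sum_aux k hk s hs.1 k
  rw [div_self hk'.ne', min_eq_left hs.2] at hsum
  have key : s - (k : ℝ) * ∑ i ∈ Finset.Icc 1 k, ospline 1 k i s * ospline 1 k i t =
      ∑ i ∈ Finset.range k, ospline 1 k (i + 1) s * (1 - k * ospline 1 k (i + 1) t) := by
    rw [← Finset.Ico_add_one_right_eq_Icc, Finset.sum_Ico_eq_sum_range]
    simp only [mul_sub, mul_one, Finset.sum_sub_distrib, hsum, Finset.mul_sum,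
      add_tsub_cancel_right]
    congr 1
    refine Finset.sum_congr rfl fun i _ => ?_
    rw [add_comm 1 i]; ring
  rw [key]
  constructor
  · refine Finset.sum_nonneg fun i _ => mul_nonneg (ospline_bounds k i s hk).1 ?_
    linarith [(ospline_bounds k i t hk).2]
  · have h5 := ospline_err k hk s k
    have h6 : (2 : ℝ) / k = 1 / k + 1 / k := by ring
    have h7 : ∑ i ∈ Finset.range k, ospline 1 k (i + 1) s * (1 - k * ospline 1 k (i + 1) t) ≤
        ∑ i ∈ Finset.range k, ospline 1 k (i + 1) s * (1 - k * ospline 1 k (i + 1) s) := by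
      refine Finset.sum_le_sum fun i _ => ?_
      refine mul_le_mul_of_nonneg_left ?_ (ospline_bounds k i s hk).1
      have := mul_le_mul_of_nonneg_left (ospline_mono k i s t hk hst) hk'.le
      linarith
    split_ifs at h5 <;> linarith

/-- Base case `p = 1` of the convergence of the O-spline approximation: the covariance
`k ∑ φ_i(s) φ_i(t)` of the order-1 O-spline approximation is within `2/k` (from below) of the
Wiener covariance `min s t`, uniformly over `s, t ∈ [0,1]`. -/
theorem ospline_order_one_covariance_bound (k : ℕ) (hk : 1 ≤ k)
    (s t : ℝ) (hs : s ∈ Set.Icc (0 : ℝ) 1) (ht : t ∈ Set.Icc (0 : ℝ) 1) :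
    0 ≤ min s t - (k : ℝ) * ∑ i ∈ Finset.Icc 1 k, ospline 1 k i s * ospline 1 k i t ∧
      min s t - (k : ℝ) * ∑ i ∈ Finset.Icc 1 k, ospline 1 k i s * ospline 1 k i t ≤ 2 / k ∧
      |min s t - (k : ℝ) * ∑ i ∈ Finset.Icc 1 k, ospline 1 k i s * ospline 1 k i t| ≤ 2 / k := by
  have main : 0 ≤ min s t - (k : ℝ) * ∑ i ∈ Finset.Icc 1 k, ospline 1 k i s * ospline 1 k i t ∧
      min s t - (k : ℝ) * ∑ i ∈ Finset.Icc 1 k, ospline 1 k i s * ospline 1 k i t ≤ 2 / k := by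
    rcases le_total s t with h | h
    · rw [min_eq_left h]
      exact ospline_main k hk s t hs h
    · rw [min_eq_right h]
      simp_rw [fun i => mul_comm (ospline 1 k i s) (ospline 1 k i t)]
      exact ospline_main k hk t s ht h
  exact ⟨main.1, main.2, by rw [abs_of_nonneg main.1]; exact main.2⟩
end

section
/- Let k ≥ 1, p ≥ 1 be integers, with equally spaced knots s_i = i/k (i = 0,…,k) on [0,1], and let φ_i^{(p)} : ℝ → ℝ be the order-p O-spline basis function (φ_i^{(p)}(x) = 0 for x ≤ s_{i−1}; (x−s_{i−1})^p/p! for s_{i−1} < x ≤ s_i; ((x−s_{i−1})^p − (x−s_i)^p)/p! for x > s_i). Then: (i) for every integer q with 0 ≤ q ≤ p−1, the q-th iterated derivative of φ_i^{(p)} vanishes at every x ≤ s_{i−1}, and in particular at x = 0; and (ii) for every x ∉ {s_{i−1}, s_i}, the p-th iterated derivative of φ_i^{(p)} at x exists and equals 1_{(s_{i−1}, s_i]}(x). -/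
open MeasureTheory

/-- Truncated power. -/
noncomputable def tpow (m : ℕ) (a x : ℝ) : ℝ :=
  if x ≤ a then 0 else (x - a) ^ m / (Nat.factorial m)

theorem ospline_eq_tpow (m k i : ℕ) : ospline m k i =
    fun x => tpow m (((i : ℝ) - 1) / k) x - tpow m ((i : ℝ) / k) x := by
  have hab : ((i : ℝ) - 1) / k ≤ (i : ℝ) / k := by gcongr; linarith
  funext x
  unfold ospline tpow
  by_cases h1 : x ≤ ((i : ℝ) - 1) / k
  · have h2 : x ≤ (i : ℝ) / k := h1.trans hab
    simp [h1, h2]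
  · by_cases h2 : x ≤ (i : ℝ) / k
    · simp [h1, h2]
    · simp only [h1, h2, if_false]; ring

theorem hasDerivAt_powdiv (m : ℕ) (a x : ℝ) :
    HasDerivAt (fun x : ℝ => (x - a) ^ (m + 1) / (Nat.factorial (m + 1) : ℝ))
      ((x - a) ^ m / (Nat.factorial m : ℝ)) x := by
  have h := (((hasDerivAt_id x).sub_const a).pow (m + 1)).div_const (Nat.factorial (m + 1) : ℝ)
  refine h.congr_deriv ?_
  have h1 : (Nat.factorial m : ℝ) ≠ 0 := by positivity
  have h2 : (m : ℝ) + 1 ≠ 0 := by positivity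
  rw [Nat.factorial_succ]
  push_cast
  simp only [id, Nat.add_sub_cancel]
  field_simp

theorem hasDerivAt_tpow_ne (m : ℕ) (a x : ℝ) (hx : x ≠ a) :
    HasDerivAt (tpow (m + 1) a) (tpow m a x) x := by
  rcases lt_or_gt_of_ne hx with h | h
  · have : tpow m a x = 0 := by simp [tpow, h.le]
    rw [this]
    refine (hasDerivAt_const x (0 : ℝ)).congr_of_eventuallyEq ?_
    filter_upwards [Iio_mem_nhds h] with y hy
    simp [tpow, (show y < a from hy).le]
  · have : tpow m a x = (x - a) ^ m / (Nat.factorial m : ℝ) := by simp [tpow, not_le.mpr h]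
    rw [this]
    refine (hasDerivAt_powdiv m a x).congr_of_eventuallyEq ?_
    filter_upwards [Ioi_mem_nhds h] with y hy
    simp [tpow, not_le.mpr (show a < y from hy)]

theorem hasDerivAt_tpow (m : ℕ) (a x : ℝ) :
    HasDerivAt (tpow (m + 2) a) (tpow (m + 1) a x) x := by
  by_cases hx : x = a
  · subst hx
    have h0 : tpow (m + 1) x x = 0 := by simp [tpow]
    rw [h0, ← hasDerivWithinAt_univ, ← Set.Iic_union_Ici (a := x)]
    apply HasDerivWithinAt.union
    · refine (hasDerivWithinAt_const x _ (0 : ℝ)).congr ?_ ?_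
      · intro y hy
        simp [tpow, (show y ≤ x from hy)]
      · simp [tpow]
    · have h := (hasDerivAt_powdiv (m + 1) x x).hasDerivWithinAt (s := Set.Ici x)
      have h1 : (x - x) ^ (m + 1) / (Nat.factorial (m + 1) : ℝ) = 0 := by simp
      rw [h1] at h
      refine h.congr ?_ ?_
      · intro y hy
        rcases eq_or_lt_of_le (show x ≤ y from hy) with h | h
        · subst h; simp [tpow]
        · simp [tpow, not_le.mpr h]
      · simp [tpow]
  · exact hasDerivAt_tpow_ne (m + 1) a x hx

theorem iteratedDeriv_ospline (k i q m : ℕ) :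
    iteratedDeriv q (ospline (m + 1 + q) k i) = ospline (m + 1) k i := by
  induction q with
  | zero => simp
  | succ q ih =>
    rw [iteratedDeriv_succ']
    have : deriv (ospline (m + 1 + (q + 1)) k i) = ospline (m + 1 + q) k i := by
      funext x
      rw [ospline_eq_tpow, ospline_eq_tpow]
      have e1 : m + 1 + (q + 1) = (m + q) + 2 := by omega
      have e2 : m + 1 + q = (m + q) + 1 := by omega
      rw [e1, e2]
      exact ((hasDerivAt_tpow _ _ x).sub (hasDerivAt_tpow _ _ x)).deriv
    rw [this, ih]

/-- Least-squares finite element conditions satisfied by the order-`p` O-spline basis: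
(i) for every `q ≤ p - 1`, the `q`-th iterated derivative vanishes at every `x ≤ s_{i-1}`
(in particular at `x = 0`); (ii) away from the two knots `s_{i-1}` and `s_i`, the `p`-th
iterated derivative exists and equals the indicator of `(s_{i-1}, s_i]`. -/
theorem ospline_fem_conditions (k p : ℕ) (hk : 1 ≤ k) (hp : 1 ≤ p)
    (i : ℕ) (hi : 1 ≤ i) (hik : i ≤ k) :
    (∀ q ≤ p - 1, ∀ x : ℝ, x ≤ ((i : ℝ) - 1) / k →
        iteratedDeriv q (ospline p k i) x = 0) ∧
      (∀ x : ℝ, x ≠ ((i : ℝ) - 1) / k → x ≠ (i : ℝ) / k →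
        HasDerivAt (iteratedDeriv (p - 1) (ospline p k i))
          (Set.indicator (Set.Ioc (((i : ℝ) - 1) / k) ((i : ℝ) / k)) (fun _ => (1 : ℝ)) x) x) := by
  constructor
  · intro q hq x hx
    obtain ⟨m, rfl⟩ : ∃ m, p = m + 1 + q := ⟨p - 1 - q, by omega⟩
    rw [iteratedDeriv_ospline]
    simp [ospline, hx]
  · intro x hxa hxb
    obtain ⟨m, rfl⟩ : ∃ m, p = 0 + 1 + m := ⟨p - 1, by omega⟩
    have e : 0 + 1 + m - 1 = m := by omega
    rw [e, iteratedDeriv_ospline, ospline_eq_tpow]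
    refine ((hasDerivAt_tpow_ne 0 _ x hxa).sub (hasDerivAt_tpow_ne 0 _ x hxb)).congr_deriv ?_
    have h := congrFun (ospline_eq_tpow 0 k i) x
    rw [← h]
    unfold ospline
    by_cases h1 : x ≤ ((i : ℝ) - 1) / k
    · simp [h1, Set.indicator, not_lt.mpr h1]
    · by_cases h2 : x ≤ (i : ℝ) / k
      · simp [h1, h2, Set.indicator, not_le.mp h1]
      · simp [h1, h2, Set.indicator]
end

section
/- Let p ≥ 1 and k ≥ 1 be integers, with equally spaced knots s_i = i/k (i = 0,…,k) on [0,1], and let φ_i^{(p)} be the order-p O-spline basis functions (φ_i^{(p)}(x) = 0 for x ≤ s_{i−1}; (x−s_{i−1})^p/p! for s_{i−1} < x ≤ s_i; ((x−s_{i−1})^p − (x−s_i)^p)/p! for x > s_i). Then sup over s, t ∈ [0,1] of | ∫₀^{min(s,t)} (s−u)^{p−1}(t−u)^{p−1}/((p−1)!)² du − k·Σ_{i=1}^k φ_i^{(p)}(s)·φ_i^{(p)}(t) | ≤ 2/k. (The first term is the covariance function C(s,t) of the p-th order integrated Wiener process W_p with σ = 1, and the second is the covariance function C_k(s,t) of its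 order-p O-spline approximation; so ||C − C_k||_∞ = O(1/k).) -/
open MeasureTheory Finset

/-- The kernel of the integrated Wiener process. -/
noncomputable def gker (q : ℕ) (s u : ℝ) : ℝ :=
  if u ≤ s then (s - u) ^ q / (Nat.factorial q : ℝ) else 0

lemma gker_nonneg (q : ℕ) (s u : ℝ) : 0 ≤ gker q s u := by
  unfold gker
  split_ifs with h
  · have : 0 ≤ s - u := by linarith
    positivity
  · exact le_rfl

lemma gker_antitone (q : ℕ) (s : ℝ) : Antitone (gker q s) := by
  intro u v huv
  by_cases hv : v ≤ s
  · unfold gker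
    rw [if_pos hv, if_pos (huv.trans hv)]
    have : 0 ≤ s - v := by linarith
    gcongr
  · have : gker q s v = 0 := by unfold gker; rw [if_neg hv]
    rw [this]; exact gker_nonneg q s u

lemma gker_le_one (q : ℕ) (s u : ℝ) (hs : s ≤ 1) (hu : 0 ≤ u) : gker q s u ≤ 1 := by
  unfold gker
  split_ifs with h
  · have h0 : 0 ≤ s - u := by linarith
    have h1 : (s - u) ^ q ≤ 1 := pow_le_one₀ h0 (by linarith)
    have h2 : (1 : ℝ) ≤ Nat.factorial q := by exact_mod_cast Nat.factorial_pos q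
    rw [div_le_one (by linarith)]
    linarith
  · exact zero_le_one

lemma gker_int (q : ℕ) (s a b : ℝ) : IntervalIntegrable (gker q s) volume a b :=
  (gker_antitone q s).intervalIntegrable

lemma gker_mul_int (q : ℕ) (s t a b : ℝ) :
    IntervalIntegrable (fun u => gker q s u * gker q t u) volume a b := by
  apply Antitone.intervalIntegrable
  intro u v huv
  exact mul_le_mul (gker_antitone q s huv) (gker_antitone q t huv) (gker_nonneg _ _ _)
    (gker_nonneg _ _ _)

lemma gker_integral_zero (q : ℕ) (s a b : ℝ) (hab : a ≤ b) (h : s ≤ a) :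
    ∫ u in a..b, gker q s u = 0 := by
  apply intervalIntegral.integral_zero_ae
  refine Filter.Eventually.of_forall fun u hu => ?_
  rw [Set.uIoc_of_le hab] at hu
  unfold gker
  rw [if_neg]
  have := hu.1
  linarith

lemma gker_integral_pos (q : ℕ) (s a b : ℝ) (hab : a ≤ b) (h : b ≤ s) :
    ∫ u in a..b, gker q s u =
      ((s - a) ^ (q + 1) - (s - b) ^ (q + 1)) / (Nat.factorial (q + 1) : ℝ) := by
  have e : ∫ u in a..b, gker q s u = ∫ u in a..b, (s - u) ^ q / (Nat.factorial q : ℝ) := by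
    apply intervalIntegral.integral_congr
    intro u hu
    rw [Set.uIcc_of_le hab] at hu
    simp only [gker]
    rw [if_pos (hu.2.trans h)]
  rw [e, intervalIntegral.integral_div,
    intervalIntegral.integral_comp_sub_left (fun x => x ^ q) s, integral_pow,
    Nat.factorial_succ]
  push_cast
  field_simp

lemma ospline_eq (q k i : ℕ) (hk : 1 ≤ k) (s : ℝ) :
    ospline (q + 1) k i s = ∫ u in (((i : ℝ) - 1) / k)..((i : ℝ) / k), gker q s u := by
  have hab : ((i : ℝ) - 1) / k ≤ (i : ℝ) / k := by gcongr; linarith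
  unfold ospline
  split_ifs with h1 h2
  · rw [gker_integral_zero q s _ _ hab h1]
  · rw [← intervalIntegral.integral_add_adjacent_intervals (gker_int q s _ s) (gker_int q s s _),
      gker_integral_zero q s s _ h2 le_rfl, gker_integral_pos q s _ s (not_le.1 h1).le le_rfl]
    simp
  · rw [gker_integral_pos q s _ _ hab (not_le.1 h2).le]

lemma cov_eq (q : ℕ) (s t : ℝ) (hs : s ∈ Set.Icc (0 : ℝ) 1) (ht : t ∈ Set.Icc (0 : ℝ) 1) :
    (∫ u in (0 : ℝ)..min s t,
        (s - u) ^ q * (t - u) ^ q / ((Nat.factorial q : ℝ) ^ 2)) =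
      ∫ u in (0 : ℝ)..1, gker q s u * gker q t u := by
  rw [← intervalIntegral.integral_add_adjacent_intervals (gker_mul_int q s t 0 (min s t))
    (gker_mul_int q s t (min s t) 1)]
  have z : ∫ u in (min s t)..1, gker q s u * gker q t u = 0 := by
    apply intervalIntegral.integral_zero_ae
    refine Filter.Eventually.of_forall fun u hu => ?_
    rw [Set.uIoc_of_le (min_le_of_left_le hs.2)] at hu
    rcases min_lt_iff.1 hu.1 with h | h
    · simp [gker, not_le.2 h]
    · simp [gker, not_le.2 h]
  rw [z, add_zero]
  apply intervalIntegral.integral_congr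
  intro u hu
  rw [Set.uIcc_of_le (le_min hs.1 ht.1)] at hu
  have h := le_min_iff.1 hu.2
  simp only [gker]
  rw [if_pos h.1, if_pos h.2]
  field_simp

/-- The estimate on one cell. -/
lemma cell_bound (q : ℕ) (s t a b K : ℝ) (hK : 0 < K) (hab : b - a = 1 / K) (ha : 0 ≤ a)
    (ht : t ≤ 1) :
    |(∫ u in a..b, gker q s u * gker q t u) -
      K * ((∫ u in a..b, gker q s u) * ∫ u in a..b, gker q t u)| ≤
      (gker q s a - gker q s b) / K := by
  have hle : a ≤ b := by have : 0 < 1 / K := by positivity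
                         linarith
  set T := ∫ u in a..b, gker q t u with hT
  set S := ∫ u in a..b, gker q s u with hS
  have hT0 : 0 ≤ T := intervalIntegral.integral_nonneg hle fun u _ => gker_nonneg _ _ _
  have hT1 : T ≤ 1 / K := by
    have := intervalIntegral.integral_mono_on hle (gker_int q t a b)
      (intervalIntegrable_const (c := (1 : ℝ)))
      (fun u hu => gker_le_one q t u ht (ha.trans hu.1))
    simpa [hab] using this
  have hS1 : K * S ≤ gker q s a := by
    have := intervalIntegral.integral_mono_on hle (gker_int q s a b)
      (intervalIntegrable_const (c := gker q s a))
      (fun u hu => gker_antitone q s hu.1)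
    rw [intervalIntegral.integral_const, hab, smul_eq_mul] at this
    calc K * S ≤ K * (1 / K * gker q s a) := by gcongr
      _ = _ := by field_simp
  have hS2 : gker q s b ≤ K * S := by
    have := intervalIntegral.integral_mono_on hle
      (intervalIntegrable_const (c := gker q s b)) (gker_int q s a b)
      (fun u hu => gker_antitone q s hu.2)
    rw [intervalIntegral.integral_const, hab, smul_eq_mul] at this
    calc gker q s b = K * (1 / K * gker q s b) := by field_simp
      _ ≤ _ := by gcongr
  have hP1 : (∫ u in a..b, gker q s u * gker q t u) ≤ gker q s a * T := by
    rw [hT, ← intervalIntegral.integral_const_mul]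
    exact intervalIntegral.integral_mono_on hle (gker_mul_int q s t a b)
      ((gker_int q t a b).const_mul _)
      (fun u hu => mul_le_mul_of_nonneg_right (gker_antitone q s hu.1) (gker_nonneg _ _ _))
  have hP2 : gker q s b * T ≤ ∫ u in a..b, gker q s u * gker q t u := by
    rw [hT, ← intervalIntegral.integral_const_mul]
    exact intervalIntegral.integral_mono_on hle ((gker_int q t a b).const_mul _)
      (gker_mul_int q s t a b)
      (fun u hu => mul_le_mul_of_nonneg_right (gker_antitone q s hu.2) (gker_nonneg _ _ _))
  have hd : 0 ≤ gker q s a - gker q s b := sub_nonneg.2 (gker_antitone q s hle)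
  have h3 : (gker q s a - gker q s b) * T ≤ (gker q s a - gker q s b) / K := by
    rw [div_eq_mul_one_div]
    gcongr
  have h4 := mul_le_mul_of_nonneg_right hS1 hT0
  have h5 := mul_le_mul_of_nonneg_right hS2 hT0
  rw [abs_le]
  constructor <;> nlinarith

theorem ospline_covariance_convergence (p k : ℕ) (hp : 1 ≤ p) (hk : 1 ≤ k)
    (s t : ℝ) (hs : s ∈ Set.Icc (0 : ℝ) 1) (ht : t ∈ Set.Icc (0 : ℝ) 1) :
    |(∫ u in (0 : ℝ)..min s t,
        (s - u) ^ (p - 1) * (t - u) ^ (p - 1) / ((Nat.factorial (p - 1) : ℝ) ^ 2)) -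
      (k : ℝ) * ∑ i ∈ Finset.Icc 1 k, ospline p k i s * ospline p k i t| ≤ 2 / k := by
  obtain ⟨q, rfl⟩ : ∃ q, p = q + 1 := ⟨p - 1, by omega⟩
  have hK : (0 : ℝ) < k := by exact_mod_cast hk
  rw [Nat.add_sub_cancel, cov_eq q s t hs ht]
  have hsum : ∑ i ∈ Finset.Icc 1 k, ospline (q + 1) k i s * ospline (q + 1) k i t =
      ∑ j ∈ Finset.range k, (∫ u in ((j : ℝ) / k)..(((j + 1 : ℕ) : ℝ) / k), gker q s u) *
        ∫ u in ((j : ℝ) / k)..(((j + 1 : ℕ) : ℝ) / k), gker q t u := by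
    have e : Finset.Icc 1 k = Finset.Ico (0 + 1) (k + 1) := by ext; simp
    rw [e, ← Finset.sum_Ico_add' (fun i : ℕ => ospline (q + 1) k i s * ospline (q + 1) k i t) 0 k 1,
      Finset.range_eq_Ico]
    refine Finset.sum_congr rfl fun j _ => ?_
    rw [ospline_eq q k _ hk, ospline_eq q k _ hk]
    simp
  have hint : ∫ u in (0 : ℝ)..1, gker q s u * gker q t u =
      ∑ j ∈ Finset.range k,
        ∫ u in ((j : ℝ) / k)..(((j + 1 : ℕ) : ℝ) / k), gker q s u * gker q t u := by
    rw [intervalIntegral.sum_integral_adjacent_intervals (a := fun j : ℕ => (j : ℝ) / k)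
      (fun j _ => gker_mul_int q s t _ _)]
    simp [hK.ne']
  rw [hsum, hint, Finset.mul_sum, ← Finset.sum_sub_distrib]
  calc _ ≤ ∑ j ∈ Finset.range k,
        (gker q s ((j : ℝ) / k) - gker q s (((j + 1 : ℕ) : ℝ) / k)) / k := by
        refine (Finset.abs_sum_le_sum_abs _ _).trans (Finset.sum_le_sum fun j _ => ?_)
        refine cell_bound q s t _ _ _ hK ?_ (by positivity) ht.2
        push_cast
        field_simp
        ring
    _ = (gker q s 0 - gker q s 1) / k := by
        rw [← Finset.sum_div, Finset.sum_range_sub' (fun j : ℕ => gker q s ((j : ℝ) / k))]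
        simp [hK.ne']
    _ ≤ 2 / k := by
        have h1 := gker_le_one q s 0 hs.2 le_rfl
        have h2 := gker_nonneg q s 1
        gcongr
        linarith
end

section
/- Let m, n ≥ 0 be integers and let I^m_s, I^n_t denote the m-fold and n-fold iterated integrals from 0 in the first and second arguments of a function of two variables, i.e. I^m_s I^n_t F(s,t) = ∫₀^s ∫₀^{s_1} ⋯ ∫₀^{s_{m−1}} ∫₀^t ∫₀^{t_1} ⋯ ∫₀^{t_{n−1}} F(s_m, t_n) dt_n ⋯ dt_1 ds_m ⋯ ds_1. Then for all s, t ≥ 0: I^m_s I^n_t [min](s,t) = ∫₀^{min(s,t)} (s−u)^m (t−u)^n / (m!·n!) du. -/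
open MeasureTheory

/-- The `p`-fold iterated integral from `0`. -/
noncomputable def iterInt : ℕ → (ℝ → ℝ) → ℝ → ℝ
  | 0, F => F
  | n + 1, F => fun x => ∫ u in (0 : ℝ)..x, iterInt n F u

/-- One integration step, by Fubini on the triangle `u ≤ y`. -/
theorem step_aux (m : ℕ) (g : ℝ → ℝ) (hg : Continuous g) (x t : ℝ) (hx : 0 ≤ x) (ht : 0 ≤ t) :
    ∫ y in (0 : ℝ)..x, (∫ u in (0 : ℝ)..min y t, (y - u) ^ m * g u) =
      ∫ u in (0 : ℝ)..min x t, (x - u) ^ (m + 1) / ((m : ℝ) + 1) * g u := by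
  have hout : ∀ (y : ℝ) (h : ℝ → ℝ), 0 ≤ y →
      ∫ u in (0 : ℝ)..min y t, h u = ∫ u in Set.Ioc 0 t, (Set.Iic y).indicator h u := by
    intro y h hy
    rw [intervalIntegral.integral_of_le (le_min hy ht),
      setIntegral_indicator measurableSet_Iic, Set.Ioc_inter_Iic, min_comm]
  rw [hout x _ hx, intervalIntegral.integral_of_le hx]
  have h1 : ∫ y in Set.Ioc 0 x, (∫ u in (0 : ℝ)..min y t, (y - u) ^ m * g u) =
      ∫ y in Set.Ioc 0 x, ∫ u in Set.Ioc 0 t,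
        (Set.Iic y).indicator (fun u => (y - u) ^ m * g u) u := by
    refine setIntegral_congr_fun measurableSet_Ioc ?_
    intro y hy
    exact hout y _ hy.1.le
  rw [h1, integral_integral_swap]
  · refine setIntegral_congr_fun measurableSet_Ioc ?_
    intro u hu
    have h2 : ∀ y : ℝ, (Set.Iic y).indicator (fun u => (y - u) ^ m * g u) u =
        (Set.Ici u).indicator (fun y => (y - u) ^ m * g u) y := by
      intro y
      simp only [Set.indicator_apply, Set.mem_Iic, Set.mem_Ici]
    simp only [h2]
    rw [setIntegral_indicator measurableSet_Ici]
    have h3 : Set.Ioc 0 x ∩ Set.Ici u = Set.Icc u x := by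
      ext y
      simp only [Set.mem_inter_iff, Set.mem_Ioc, Set.mem_Ici, Set.mem_Icc]
      have := hu.1
      constructor
      · rintro ⟨⟨_, b⟩, c⟩
        exact ⟨c, b⟩
      · rintro ⟨c, b⟩
        exact ⟨⟨by linarith, b⟩, c⟩
    rw [h3]
    by_cases hux : u ≤ x
    · rw [integral_Icc_eq_integral_Ioc, ← intervalIntegral.integral_of_le hux,
        intervalIntegral.integral_mul_const,
        intervalIntegral.integral_comp_sub_right (fun z => z ^ m) u, integral_pow]
      simp [Set.indicator_apply, hux]
    · simp [Set.indicator_apply, hux, Set.Icc_eq_empty hux]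
  · rw [Measure.prod_restrict]
    have hc : Continuous (fun p : ℝ × ℝ => (p.1 - p.2) ^ m * g p.2) := by fun_prop
    have hi : IntegrableOn (fun p : ℝ × ℝ => (p.1 - p.2) ^ m * g p.2)
        (Set.Ioc 0 x ×ˢ Set.Ioc 0 t) (volume.prod volume) :=
      (hc.continuousOn.integrableOn_compact
        ((isCompact_Icc (a := (0 : ℝ)) (b := x)).prod (isCompact_Icc (a := (0 : ℝ)) (b := t)))).mono_set
        (Set.prod_mono Set.Ioc_subset_Icc_self Set.Ioc_subset_Icc_self)
    have hm : MeasurableSet {p : ℝ × ℝ | p.2 ≤ p.1} := measurableSet_le measurable_snd measurable_fst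
    refine (Integrable.indicator hi hm).congr (Filter.Eventually.of_forall ?_)
    rintro ⟨y, u⟩
    simp [Set.indicator_apply, Function.uncurry]

theorem iter_aux (t : ℝ) (ht : 0 ≤ t) (g : ℝ → ℝ) (hg : Continuous g) (f : ℝ → ℝ)
    (hf : ∀ y, 0 ≤ y → f y = ∫ u in (0 : ℝ)..min y t, g u) (m : ℕ) :
    ∀ x, 0 ≤ x → iterInt m f x =
      ∫ u in (0 : ℝ)..min x t, (x - u) ^ m * (g u / (Nat.factorial m : ℝ)) := by
  induction m with
  | zero =>
    intro x hx
    simp [iterInt, hf x hx]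
  | succ m ih =>
    intro x hx
    have h1 : iterInt (m + 1) f x = ∫ y in (0 : ℝ)..x,
        (∫ u in (0 : ℝ)..min y t, (y - u) ^ m * (g u / (Nat.factorial m : ℝ))) := by
      simp only [iterInt]
      refine intervalIntegral.integral_congr ?_
      intro y hy
      rw [Set.uIcc_of_le hx] at hy
      exact ih y hy.1
    rw [h1, step_aux m _ (by fun_prop) x t hx ht]
    congr 1
    ext u
    have : (m : ℝ) + 1 ≠ 0 := by positivity
    have : (Nat.factorial m : ℝ) ≠ 0 := by positivity
    rw [Nat.factorial_succ]
    push_cast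
    field_simp

/-- Iterating the integral of `min(s,t)` (the Wiener covariance) `m` times in the first
argument and `n` times in the second argument gives the closed-form kernel
`∫₀^{min(s,t)} (s-u)^m (t-u)^n / (m! n!) du`. -/
theorem iterated_integral_min (m n : ℕ) (s t : ℝ) (hs : 0 ≤ s) (ht : 0 ≤ t) :
    iterInt m (fun s' => iterInt n (fun t' => min s' t') t) s =
      ∫ u in (0 : ℝ)..min s t,
        (s - u) ^ m * (t - u) ^ n / ((Nat.factorial m : ℝ) * (Nat.factorial n : ℝ)) := by
  rw [iter_aux t ht (fun u => (t - u) ^ n * (1 / (Nat.factorial n : ℝ))) (by fun_prop) _ ?_ m s hs]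
  · congr 1
    ext u
    have : (Nat.factorial n : ℝ) ≠ 0 := by positivity
    have : (Nat.factorial m : ℝ) ≠ 0 := by positivity
    field_simp
  · intro y hy
    have := iter_aux y hy (fun _ => 1) continuous_const (fun t' => min y t')
      (by intro z hz; simp [min_comm]) n t ht
    rw [this, min_comm]
end
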